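/- Let (X, d) be a complete separable metric space, let f₁, …, f_M : X → X be maps such that each f_m is Lipschitz with constant l_m < 1, and let p₁, …, p_M : X → [0,1] be Lipschitz continuous with Σ_m p_m(x) = 1 and p_m(x) ≥ δ > 0 for all x and m. Let μ be the unique invariant probability measure of the Markov kernel κ(x) = Σ_m p_m(x)·δ_{f_m(x)}. Then for every deterministic initial condition x₀ ∈ X and every bounded continuous function g : X → ℝ, the time averages (1/(k+1)) Σ_{ν=0}^{k} g(X(ν)) converge, almost surely with respect to the path measure P_{δ_{x₀}} of the chain started at x₀, to the expectation ∫ g dμ; in particular, the limit is independent of x₀. -/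

import Mathlib

open MeasureTheory ProbabilityTheory Filter Topology

/-- The finite-dimensional distributions of the time-homogeneous Markov chain with
transition kernel `κ` and initial distribution `lam`: `finiteDimLaw κ lam n` is the joint
law of the first `n+1` states. -/
noncomputable def finiteDimLaw {X : Type*} [MeasurableSpace X]
    (κ : Kernel X X) (lam : Measure X) : (n : ℕ) → Measure (Fin (n + 1) → X)
  | 0 => lam.map (fun x _ => x)
  | n + 1 => (finiteDimLaw κ lam n).bind
      (fun xs => (κ (xs (Fin.last n))).map (fun y => Fin.snoc xs y))

/-- `P` is the path measure (on the path space `ℕ → X` with the product σ-algebra) of the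
time-homogeneous Markov chain with transition kernel `κ` and initial distribution `lam`,
i.e. all its finite-dimensional marginals are the ones prescribed by `κ` and `lam`. -/
def IsPathMeasure {X : Type*} [MeasurableSpace X] (κ : Kernel X X) (lam : Measure X)
    (P : Measure (ℕ → X)) : Prop :=
  ∀ n : ℕ, P.map (fun ω (i : Fin (n + 1)) => ω (i : ℕ)) = finiteDimLaw κ lam n

/-- The transfer operator `g ↦ ∑ m, p m * g ∘ f m` of an iterated function system with
place-dependent probabilities. -/
def ifsOp {ι X : Type*} [Fintype ι] (p : ι → X → ℝ) (f : ι → X → X) (g : X → ℝ) (x : X) : ℝ :=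
  ∑ m, p m x * g (f m x)

theorem abs_weighted_sum_sub_le {ι : Type*} [Fintype ι] {u v a b : ι → ℝ} {s O : ℝ}
    (hu : ∀ i, 0 ≤ u i) (hv : ∀ i, 0 ≤ v i) (hus : ∑ i, u i = s) (hvs : ∑ i, v i = s)
    (hab : ∀ i j, |a i - b j| ≤ O) :
    |∑ i, u i * a i - ∑ i, v i * b i| ≤ s * O := by
  have hs : 0 ≤ s := hus ▸ Finset.sum_nonneg fun i _ => hu i
  rcases hs.eq_or_lt with rfl | hs
  · have hu0 : ∀ i, u i = 0 := fun i =>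
      (Finset.sum_eq_zero_iff_of_nonneg fun i _ => hu i).1 hus i (Finset.mem_univ i)
    have hv0 : ∀ i, v i = 0 := fun i =>
      (Finset.sum_eq_zero_iff_of_nonneg fun i _ => hv i).1 hvs i (Finset.mem_univ i)
    simp [hu0, hv0]
  · have key : s * (∑ i, u i * a i - ∑ i, v i * b i)
        = ∑ i, ∑ j, u i * v j * (a i - b j) := by
      have h1 : ∑ i, ∑ j, u i * v j * (a i - b j)
          = ∑ i, (u i * a i * s - u i * ∑ j, v j * b j) := by
        refine Finset.sum_congr rfl fun i _ => ?_
        rw [← hvs, Finset.mul_sum, Finset.mul_sum, ← Finset.sum_sub_distrib]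
        exact Finset.sum_congr rfl fun j _ => by ring
      rw [h1, Finset.sum_sub_distrib, ← Finset.sum_mul, ← Finset.sum_mul, hus]
      ring
    have h2 : s * |∑ i, u i * a i - ∑ i, v i * b i| ≤ s * (s * O) := by
      calc s * |∑ i, u i * a i - ∑ i, v i * b i|
          = |∑ i, ∑ j, u i * v j * (a i - b j)| := by rw [← key, abs_mul, abs_of_pos hs]
        _ ≤ ∑ i, ∑ j, u i * v j * O := by
            refine (Finset.abs_sum_le_sum_abs _ _).trans (Finset.sum_le_sum fun i _ =>
              (Finset.abs_sum_le_sum_abs _ _).trans (Finset.sum_le_sum fun j _ => ?_))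
            rw [abs_mul, abs_of_nonneg (mul_nonneg (hu i) (hv j))]
            exact mul_le_mul_of_nonneg_left (hab i j) (mul_nonneg (hu i) (hv j))
        _ = s * (s * O) := by
            simp_rw [← Finset.sum_mul, ← Finset.mul_sum, hvs, ← Finset.sum_mul, hus]
            ring
    exact le_of_mul_le_mul_left h2 hs

section Oscillation

variable {ι X : Type*} [Fintype ι] {p : ι → X → ℝ} {f : ι → X → X}

theorem abs_ifsOp_le {g : X → ℝ} {C : ℝ} (hp0 : ∀ m x, 0 ≤ p m x)
    (hpsum : ∀ x, ∑ m, p m x = 1) (hg : ∀ x, |g x| ≤ C) (x : X) :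
    |ifsOp p f g x| ≤ C := by
  calc |ifsOp p f g x| ≤ ∑ m, p m x * C := by
        refine (Finset.abs_sum_le_sum_abs _ _).trans (Finset.sum_le_sum fun m _ => ?_)
        rw [abs_mul, abs_of_nonneg (hp0 m x)]
        exact mul_le_mul_of_nonneg_left (hg _) (hp0 m x)
    _ = C := by rw [← Finset.sum_mul, hpsum, one_mul]

theorem abs_iterate_ifsOp_le {g : X → ℝ} {C : ℝ} (hp0 : ∀ m x, 0 ≤ p m x)
    (hpsum : ∀ x, ∑ m, p m x = 1) (hg : ∀ x, |g x| ≤ C) (n : ℕ) (x : X) :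
    |(ifsOp p f)^[n] g x| ≤ C := by
  induction n generalizing x with
  | zero => exact hg x
  | succ n ih =>
    rw [Function.iterate_succ_apply']
    exact abs_ifsOp_le hp0 hpsum ih x

theorem continuous_iterate_ifsOp [TopologicalSpace X] {g : X → ℝ} (hp : ∀ m, Continuous (p m))
    (hf : ∀ m, Continuous (f m)) (hg : Continuous g) (n : ℕ) :
    Continuous ((ifsOp p f)^[n] g) := by
  induction n with
  | zero => exact hg
  | succ n ih =>
    rw [Function.iterate_succ_apply']
    exact continuous_finsetSum _ fun m _ => (hp m).mul (ih.comp (hf m))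

theorem abs_ifsOp_sub_le_of_osc {B : Set X} {δ : ℝ} (hpδ : ∀ m x, δ ≤ p m x)
    (hpsum : ∀ x, ∑ m, p m x = 1)
    (hδ : 0 ≤ δ) (hB : ∀ m, Set.MapsTo (f m) B B)
    {h : X → ℝ} {O : ℝ} (hO : ∀ x ∈ B, ∀ y ∈ B, |h x - h y| ≤ O)
    {x y : X} (hx : x ∈ B) (hy : y ∈ B) :
    |ifsOp p f h x - ifsOp p f h y| ≤ O := by
  have := abs_weighted_sum_sub_le (fun m => hδ.trans (hpδ m x)) (fun m => hδ.trans (hpδ m y))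
    (hpsum x) (hpsum y) fun i j => hO _ (hB i hx) _ (hB j hy)
  simpa [ifsOp] using this

variable [PseudoMetricSpace X] {B : Set X} {δ r K D : ℝ}

theorem abs_ifsOp_sub_le (hpδ : ∀ m x, δ ≤ p m x) (hpsum : ∀ x, ∑ m, p m x = 1) (hδ : 0 ≤ δ)
    (hf : ∀ m x y, dist (f m x) (f m y) ≤ r * dist x y) (hB : ∀ m, Set.MapsTo (f m) B B)
    {h : X → ℝ} {O A C : ℝ} (hC : 0 ≤ C) (hO : ∀ x ∈ B, ∀ y ∈ B, |h x - h y| ≤ O)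
    (hA : ∀ x ∈ B, ∀ y ∈ B, |h x - h y| ≤ A + C * dist x y)
    {x y : X} (hx : x ∈ B) (hy : y ∈ B) :
    |ifsOp p f h x - ifsOp p f h y| ≤
      Fintype.card ι * δ * (A + C * (r * dist x y)) + (1 - Fintype.card ι * δ) * O := by
  have hsum : ∀ z, ∑ m, (p m z - δ) = 1 - Fintype.card ι * δ := fun z => by
    rw [Finset.sum_sub_distrib, hpsum]; simp
  have hsplit : ifsOp p f h x - ifsOp p f h y = (∑ m, δ * (h (f m x) - h (f m y))) +
      (∑ m, (p m x - δ) * h (f m x) - ∑ m, (p m y - δ) * h (f m y)) := by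
    simp only [ifsOp, ← Finset.sum_sub_distrib, ← Finset.sum_add_distrib]
    exact Finset.sum_congr rfl fun m _ => by ring
  rw [hsplit]
  refine (abs_add_le _ _).trans (add_le_add ?_ ?_)
  · calc |∑ m, δ * (h (f m x) - h (f m y))|
        ≤ ∑ m : ι, δ * (A + C * (r * dist x y)) := by
          refine (Finset.abs_sum_le_sum_abs _ _).trans (Finset.sum_le_sum fun m _ => ?_)
          rw [abs_mul, abs_of_nonneg hδ]
          refine mul_le_mul_of_nonneg_left ((hA _ (hB m hx) _ (hB m hy)).trans ?_) hδ
          have := mul_le_mul_of_nonneg_left (hf m x y) hC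
          linarith
      _ = _ := by simp; ring
  · exact abs_weighted_sum_sub_le (fun m => sub_nonneg.2 (hpδ m x))
      (fun m => sub_nonneg.2 (hpδ m y)) (hsum x) (hsum y)
      fun i j => hO _ (hB i hx) _ (hB j hy)

theorem abs_ifsOp_sub_le_of_lipschitz (hp0 : ∀ m x, 0 ≤ p m x) (hpsum : ∀ x, ∑ m, p m x = 1)
    (hpK : ∀ m x y, |p m x - p m y| ≤ K * dist x y)
    (hf : ∀ m x y, dist (f m x) (f m y) ≤ r * dist x y) (hB : ∀ m, Set.MapsTo (f m) B B)
    {h : X → ℝ} {O L : ℝ} (hL : 0 ≤ L) (hO : ∀ x ∈ B, ∀ y ∈ B, |h x - h y| ≤ O)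
    (hA : ∀ x ∈ B, ∀ y ∈ B, |h x - h y| ≤ L * dist x y)
    {x y : X} (hx : x ∈ B) (hy : y ∈ B) :
    |ifsOp p f h x - ifsOp p f h y| ≤ (r * L + Fintype.card ι * K * O) * dist x y := by
  have hsplit : ifsOp p f h x - ifsOp p f h y = (∑ m, p m x * (h (f m x) - h (f m y))) +
      ∑ m, (p m x - p m y) * (h (f m y) - h y) := by
    have h0 : ∑ m, (p m x - p m y) * h y = 0 := by
      rw [← Finset.sum_mul, Finset.sum_sub_distrib, hpsum, hpsum]; ring
    rw [← sub_eq_zero, ← h0]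
    simp only [ifsOp, ← Finset.sum_sub_distrib, ← Finset.sum_add_distrib]
    exact Finset.sum_congr rfl fun m _ => by ring
  rw [hsplit, add_mul]
  refine (abs_add_le _ _).trans (add_le_add ?_ ?_)
  · calc |∑ m, p m x * (h (f m x) - h (f m y))|
        ≤ ∑ m : ι, p m x * (L * (r * dist x y)) := by
          refine (Finset.abs_sum_le_sum_abs _ _).trans (Finset.sum_le_sum fun m _ => ?_)
          rw [abs_mul, abs_of_nonneg (hp0 m x)]
          exact mul_le_mul_of_nonneg_left ((hA _ (hB m hx) _ (hB m hy)).trans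
            (mul_le_mul_of_nonneg_left (hf m x y) hL)) (hp0 m x)
      _ = _ := by rw [← Finset.sum_mul, hpsum]; ring
  · calc |∑ m, (p m x - p m y) * (h (f m y) - h y)|
        ≤ ∑ m : ι, K * dist x y * O := by
          refine (Finset.abs_sum_le_sum_abs _ _).trans (Finset.sum_le_sum fun m _ => ?_)
          rw [abs_mul]
          exact mul_le_mul (hpK m x y) (hO _ (hB m hy) _ hy) (abs_nonneg _)
            ((abs_nonneg _).trans (hpK m x y))
      _ = _ := by simp; ring

theorem abs_iterate_ifsOp_sub_le (hpδ : ∀ m x, δ ≤ p m x) (hpsum : ∀ x, ∑ m, p m x = 1)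
    (hδ : 0 ≤ δ) (hr : 0 ≤ r)
    (hf : ∀ m x y, dist (f m x) (f m y) ≤ r * dist x y) (hB : ∀ m, Set.MapsTo (f m) B B)
    {h : X → ℝ} {O L : ℝ} (hL : 0 ≤ L) (hO : ∀ x ∈ B, ∀ y ∈ B, |h x - h y| ≤ O)
    (hA : ∀ x ∈ B, ∀ y ∈ B, |h x - h y| ≤ L * dist x y) (n : ℕ) :
    ∀ x ∈ B, ∀ y ∈ B, |(ifsOp p f)^[n] h x - (ifsOp p f)^[n] h y| ≤ O ∧
      |(ifsOp p f)^[n] h x - (ifsOp p f)^[n] h y| ≤ (1 - (Fintype.card ι * δ) ^ n) * O +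
        (Fintype.card ι * δ) ^ n * r ^ n * L * dist x y := by
  induction n with
  | zero => exact fun x hx y hy => ⟨hO x hx y hy, by simpa using hA x hx y hy⟩
  | succ n ih =>
    intro x hx y hy
    rw [Function.iterate_succ_apply']
    refine ⟨abs_ifsOp_sub_le_of_osc hpδ hpsum hδ hB (fun a ha b hb => (ih a ha b hb).1) hx hy, ?_⟩
    refine (abs_ifsOp_sub_le hpδ hpsum hδ hf hB (by positivity)
      (fun a ha b hb => (ih a ha b hb).1) (fun a ha b hb => (ih a ha b hb).2) hx hy).trans_eq ?_
    ring

/-- On a bounded forward-invariant set, the oscillation of the iterates of the transfer operator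
applied to a Lipschitz function tends to zero. -/
theorem eventually_abs_iterate_ifsOp_sub_le [Nonempty ι] (hpδ : ∀ m x, δ ≤ p m x)
    (hpsum : ∀ x, ∑ m, p m x = 1)
    (hδ : 0 < δ) (hr : 0 ≤ r) (hr1 : r < 1) (hK : 0 ≤ K)
    (hpK : ∀ m x y, |p m x - p m y| ≤ K * dist x y)
    (hf : ∀ m x y, dist (f m x) (f m y) ≤ r * dist x y) (hB : ∀ m, Set.MapsTo (f m) B B)
    (hD : ∀ x ∈ B, ∀ y ∈ B, dist x y ≤ D)
    {g : X → ℝ} {L : ℝ} (hL : 0 ≤ L) (hg : ∀ x y, |g x - g y| ≤ L * dist x y)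
    {ε : ℝ} (hε : 0 < ε) :
    ∀ᶠ n in atTop, ∀ x ∈ B, ∀ y ∈ B, |(ifsOp p f)^[n] g x - (ifsOp p f)^[n] g y| ≤ ε := by
  rcases B.eq_empty_or_nonempty with rfl | ⟨z, hz⟩
  · simp
  have hD0 : 0 ≤ D := dist_nonneg.trans (hD z hz z hz)
  set q : ℝ := Fintype.card ι * δ with hq
  have hq0 : 0 < q := mul_pos (by exact_mod_cast Fintype.card_pos) hδ
  have hq1 : q ≤ 1 := by
    rw [← hpsum z, hq, ← nsmul_eq_mul]
    exact Finset.card_nsmul_le_sum _ _ _ fun m _ => hpδ m z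
  set O₀ : ℝ := L * D with hO₀
  have hO₀0 : 0 ≤ O₀ := by positivity
  set c : ℝ := Fintype.card ι * K * O₀ with hc
  have hc0 : 0 ≤ c := by positivity
  set L' : ℝ := L + c / (1 - r) with hL'
  have hr1' : 0 < 1 - r := sub_pos.2 hr1
  have hL'0 : 0 ≤ L' := by positivity
  have hstep : r * L' + c ≤ L' := by
    have : (1 - r) * L' = (1 - r) * L + c := by rw [hL']; field_simp
    nlinarith [mul_nonneg hr1'.le hL]
  have hunif : ∀ n, (∀ x ∈ B, ∀ y ∈ B, |(ifsOp p f)^[n] g x - (ifsOp p f)^[n] g y| ≤ O₀) ∧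
      ∀ x ∈ B, ∀ y ∈ B, |(ifsOp p f)^[n] g x - (ifsOp p f)^[n] g y| ≤ L' * dist x y := by
    intro n
    induction n with
    | zero =>
      refine ⟨fun x hx y hy => (hg x y).trans (mul_le_mul_of_nonneg_left (hD x hx y hy) hL),
        fun x hx y hy => (hg x y).trans (mul_le_mul_of_nonneg_right ?_ dist_nonneg)⟩
      rw [hL']
      have : 0 ≤ c / (1 - r) := by positivity
      linarith
    | succ n ih =>
      simp only [Function.iterate_succ_apply']
      refine ⟨fun x hx y hy => abs_ifsOp_sub_le_of_osc hpδ hpsum hδ.le hB ih.1 hx hy,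
        fun x hx y hy => (abs_ifsOp_sub_le_of_lipschitz (fun m x => hδ.le.trans (hpδ m x)) hpsum
          hpK hf hB hL'0 ih.1 ih.2 hx hy).trans (mul_le_mul_of_nonneg_right hstep dist_nonneg)⟩
  set S : Set ℝ := {O | ∃ k, ∀ x ∈ B, ∀ y ∈ B,
    |(ifsOp p f)^[k] g x - (ifsOp p f)^[k] g y| ≤ O} with hS
  have hSne : S.Nonempty := ⟨O₀, 0, (hunif 0).1⟩
  have hSbdd : BddBelow S := ⟨0, fun O ⟨k, hk⟩ => (abs_nonneg _).trans (hk z hz z hz)⟩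
  have himp : ∀ n : ℕ, ∀ O ∈ S, (1 - q ^ n) * O + q ^ n * r ^ n * L' * D ∈ S := by
    rintro n O ⟨k, hk⟩
    refine ⟨n + k, fun x hx y hy => ?_⟩
    rw [Function.iterate_add_apply]
    refine (abs_iterate_ifsOp_sub_le hpδ hpsum hδ.le hr hf hB hL'0 hk (hunif k).2 n
      x hx y hy).2.trans ?_
    have := mul_le_mul_of_nonneg_left (hD x hx y hy)
      (show 0 ≤ q ^ n * r ^ n * L' by positivity)
    linarith
  have hle : ∀ n : ℕ, sInf S ≤ r ^ n * L' * D := by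
    intro n
    have hqn : 0 < q ^ n := pow_pos hq0 n
    have hqn1 : q ^ n ≤ 1 := pow_le_one₀ hq0.le hq1
    have h1 : sInf S ≤ (1 - q ^ n) * sInf S + q ^ n * r ^ n * L' * D := by
      refine le_of_forall_pos_le_add fun η hη => ?_
      obtain ⟨O, hOS, hO⟩ := exists_lt_of_csInf_lt hSne (lt_add_of_pos_right (sInf S) hη)
      have h2 := csInf_le hSbdd (himp n O hOS)
      nlinarith [mul_le_mul_of_nonneg_left hO.le (sub_nonneg.2 hqn1), mul_pos hqn hη]
    have h3 : q ^ n * sInf S ≤ q ^ n * (r ^ n * L' * D) := by linarith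
    exact le_of_mul_le_mul_left h3 hqn
  have hlim : Tendsto (fun n : ℕ => r ^ n * L' * D) atTop (𝓝 (0 * L' * D)) :=
    ((tendsto_pow_atTop_nhds_zero_of_lt_one hr hr1).mul_const _).mul_const _
  have h0 : sInf S ≤ 0 := by
    simpa using ge_of_tendsto' hlim hle
  obtain ⟨O, ⟨k, hk⟩, hO⟩ := exists_lt_of_csInf_lt hSne (h0.trans_lt hε)
  filter_upwards [eventually_ge_atTop k] with n hn
  obtain ⟨j, rfl⟩ := Nat.exists_eq_add_of_le' hn
  intro x hx y hy
  rw [Function.iterate_add_apply]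
  exact (abs_iterate_ifsOp_sub_le hpδ hpsum hδ.le hr hf hB hL'0 hk (hunif k).2 j
      x hx y hy).1.trans hO.le

end Oscillation

theorem tendsto_sum_div_of_tendsto_sq {a : ℕ → ℝ} {C : ℝ} (ha : ∀ i, |a i| ≤ C)
    (h : Tendsto (fun k : ℕ => (∑ i ∈ Finset.range (k ^ 2), a i) / (k : ℝ) ^ 2) atTop (𝓝 0)) :
    Tendsto (fun n : ℕ => (∑ i ∈ Finset.range n, a i) / (n : ℝ)) atTop (𝓝 0) := by
  have hC : 0 ≤ C := (abs_nonneg _).trans (ha 0)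
  have hsqrt : Tendsto Nat.sqrt atTop atTop :=
    tendsto_atTop_atTop.2 fun b => ⟨b ^ 2, fun n hn => Nat.le_sqrt'.2 hn⟩
  have hb : Tendsto (fun k : ℕ => |(∑ i ∈ Finset.range (k ^ 2), a i) / (k : ℝ) ^ 2| +
      2 * C / (k : ℝ)) atTop (𝓝 0) := by
    simpa using h.abs.add (tendsto_const_div_atTop_nhds_zero_nat (2 * C))
  refine squeeze_zero_norm' ?_ (hb.comp hsqrt)
  filter_upwards [eventually_ge_atTop 1] with n hn
  simp only [Function.comp_apply]
  set k := n.sqrt with hk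
  have hk1 : 1 ≤ k := Nat.le_sqrt'.2 (by simpa using hn)
  have hkn : k ^ 2 ≤ n := Nat.sqrt_le' n
  have hkn2 : n ≤ k ^ 2 + 2 * k := by
    have := Nat.sqrt_le_add n
    rw [← hk] at this
    nlinarith
  have hk0 : (0 : ℝ) < k := by exact_mod_cast hk1
  have hkn' : (k : ℝ) ^ 2 ≤ n := by exact_mod_cast hkn
  have hkn2' : (n : ℝ) ≤ k ^ 2 + 2 * k := by exact_mod_cast hkn2
  have hn0 : (0 : ℝ) < n := by exact_mod_cast hn
  have hS : |∑ i ∈ Finset.range n, a i| ≤ |∑ i ∈ Finset.range (k ^ 2), a i| + C * (2 * k) := by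
    rw [← Finset.sum_range_add_sum_Ico a hkn]
    refine (abs_add_le _ _).trans (add_le_add le_rfl ?_)
    calc |∑ i ∈ Finset.Ico (k ^ 2) n, a i| ≤ ∑ i ∈ Finset.Ico (k ^ 2) n, C :=
          (Finset.abs_sum_le_sum_abs _ _).trans (Finset.sum_le_sum fun i _ => ha i)
      _ = C * (n - k ^ 2) := by simp [Nat.cast_sub hkn]; ring
      _ ≤ C * (2 * k) := mul_le_mul_of_nonneg_left (by linarith) hC
  rw [Real.norm_eq_abs, abs_div, abs_div, abs_of_pos hn0, abs_of_pos (pow_pos hk0 2)]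
  calc |∑ i ∈ Finset.range n, a i| / n
      ≤ (|∑ i ∈ Finset.range (k ^ 2), a i| + C * (2 * k)) / n := by gcongr
    _ ≤ (|∑ i ∈ Finset.range (k ^ 2), a i| + C * (2 * k)) / k ^ 2 := by gcongr
    _ = |∑ i ∈ Finset.range (k ^ 2), a i| / k ^ 2 + 2 * C / k := by field_simp

theorem ae_tendsto_of_orthogonal {Ω : Type*} [MeasurableSpace Ω] {P : Measure Ω}
    [IsProbabilityMeasure P] {ξ : ℕ → Ω → ℝ} {C : ℝ} (hm : ∀ i, Measurable (ξ i))
    (hC : ∀ i ω, |ξ i ω| ≤ C) (horth : ∀ i j, i < j → ∫ ω, ξ i ω * ξ j ω ∂P = 0) :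
    ∀ᵐ ω ∂P, Tendsto (fun n : ℕ => (∑ i ∈ Finset.range n, ξ i ω) / (n : ℝ)) atTop (𝓝 0) := by
  have hint2 : ∀ i j, Integrable (fun ω => ξ i ω * ξ j ω) P := fun i j =>
    Integrable.of_bound ((hm i).mul (hm j)).aestronglyMeasurable (C * C) <| ae_of_all _ fun ω => by
      rw [norm_mul]
      exact mul_le_mul (hC i ω) (hC j ω) (abs_nonneg _) ((abs_nonneg _).trans (hC i ω))
  have hsq : ∀ n : ℕ, Integrable (fun ω => (∑ i ∈ Finset.range n, ξ i ω) ^ 2) P := fun n => by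
    simp only [sq, Finset.sum_mul_sum]
    exact integrable_finsetSum _ fun i _ => integrable_finsetSum _ fun j _ => hint2 i j
  have hbound : ∀ n : ℕ, ∫ ω, (∑ i ∈ Finset.range n, ξ i ω) ^ 2 ∂P ≤ C ^ 2 * n := by
    intro n
    induction n with
    | zero => simp
    | succ n ih =>
      have hexp : ∀ ω, (∑ i ∈ Finset.range (n + 1), ξ i ω) ^ 2 =
          (∑ i ∈ Finset.range n, ξ i ω) ^ 2 + 2 * (∑ i ∈ Finset.range n, ξ i ω * ξ n ω) +
            ξ n ω * ξ n ω := fun ω => by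
        rw [Finset.sum_range_succ, ← Finset.sum_mul]; ring
      have hcross : Integrable (fun ω => 2 * ∑ i ∈ Finset.range n, ξ i ω * ξ n ω) P :=
        (integrable_finsetSum _ fun i _ => hint2 i n).const_mul 2
      simp_rw [hexp]
      rw [integral_add (by exact (hsq n).add hcross) (hint2 n n), integral_add (hsq n) hcross,
        integral_const_mul, integral_finsetSum _ fun i _ => hint2 i n,
        Finset.sum_eq_zero fun i hi => horth i n (Finset.mem_range.1 hi)]
      have hlast : ∫ ω, ξ n ω * ξ n ω ∂P ≤ C ^ 2 := by
        calc ∫ ω, ξ n ω * ξ n ω ∂P ≤ ∫ _, C ^ 2 ∂P :=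
              integral_mono (hint2 n n) (integrable_const _) fun ω => by
                simp only [← sq]
                exact sq_le_sq' (abs_le.1 (hC n ω)).1 (abs_le.1 (hC n ω)).2
          _ = C ^ 2 := by simp
      push_cast
      linarith
  have hFint : ∀ k : ℕ, Integrable
      (fun ω => ((∑ i ∈ Finset.range (k ^ 2), ξ i ω) / (k : ℝ) ^ 2) ^ 2) P := fun k => by
    simp_rw [div_pow]
    exact (hsq _).div_const _
  have hFle : ∀ k : ℕ, ∫ ω, ((∑ i ∈ Finset.range (k ^ 2), ξ i ω) / (k : ℝ) ^ 2) ^ 2 ∂P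
      ≤ C ^ 2 * (1 / (k : ℝ) ^ 2) := fun k => by
    rcases Nat.eq_zero_or_pos k with rfl | hk
    · simp
    have hk0 : (0 : ℝ) < k := by exact_mod_cast hk
    simp_rw [div_pow]
    rw [integral_div, div_le_iff₀ (by positivity)]
    refine (hbound _).trans_eq ?_
    push_cast
    field_simp
  have hsum : ∑' k : ℕ, ∫⁻ ω, ENNReal.ofReal
      (((∑ i ∈ Finset.range (k ^ 2), ξ i ω) / (k : ℝ) ^ 2) ^ 2) ∂P ≠ ⊤ := by
    have hs : Summable fun k : ℕ => C ^ 2 * (1 / (k : ℝ) ^ 2) :=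
      (Real.summable_one_div_nat_pow.2 one_lt_two).mul_left _
    refine ne_top_of_le_ne_top hs.tsum_ofReal_ne_top (ENNReal.tsum_le_tsum fun k => ?_)
    rw [← ofReal_integral_eq_lintegral_ofReal (hFint k) (ae_of_all _ fun ω => sq_nonneg _)]
    exact ENNReal.ofReal_le_ofReal (hFle k)
  have hmeas : ∀ k : ℕ, Measurable fun ω => ENNReal.ofReal
      (((∑ i ∈ Finset.range (k ^ 2), ξ i ω) / (k : ℝ) ^ 2) ^ 2) := fun k => by fun_prop
  rw [← lintegral_tsum fun k => (hmeas k).aemeasurable] at hsum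
  filter_upwards [ae_lt_top (Measurable.tsum hmeas) hsum] with ω hω
  refine tendsto_sum_div_of_tendsto_sq (fun i => hC i ω) ?_
  have h1 := ENNReal.tendsto_atTop_zero_of_tsum_ne_top hω.ne
  have h2 := (ENNReal.tendsto_toReal ENNReal.zero_ne_top).comp h1
  simp only [Function.comp_def, ENNReal.toReal_ofReal (sq_nonneg _), ENNReal.toReal_zero] at h2
  have h3 := (Real.continuous_sqrt.tendsto 0).comp h2
  simp only [Function.comp_def, Real.sqrt_sq_eq_abs, Real.sqrt_zero] at h3
  exact (tendsto_zero_iff_abs_tendsto_zero _).2 h3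

theorem measurable_finSnoc (X : Type*) [MeasurableSpace X] (n : ℕ) : Measurable
    (fun z : (Fin (n + 1) → X) × X => (Fin.snoc z.1 z.2 : Fin (n + 2) → X)) := by
  refine measurable_pi_iff.2 fun i => ?_
  induction i using Fin.lastCases with
  | last => simpa using measurable_snd
  | cast i => simpa [Function.comp_def] using (measurable_pi_apply i).comp measurable_fst

theorem finiteDimLaw_succ_eq_map_compProd {X : Type*} [MeasurableSpace X] (κ : Kernel X X)
    [IsSFiniteKernel κ] (lam : Measure X) (n : ℕ) [SFinite (finiteDimLaw κ lam n)] :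
    finiteDimLaw κ lam (n + 1) =
      (finiteDimLaw κ lam n ⊗ₘ κ.comap (fun xs : Fin (n + 1) → X => xs (Fin.last n))
        (measurable_pi_apply _)).map
        (fun z : (Fin (n + 1) → X) × X => (Fin.snoc z.1 z.2 : Fin (n + 2) → X)) := by
  have hsnoc := measurable_finSnoc X n
  have hsnoc' : ∀ xs : Fin (n + 1) → X, Measurable
      (fun y => (Fin.snoc xs y : Fin (n + 2) → X)) := fun xs =>
    hsnoc.comp measurable_prodMk_left
  ext s hs
  have happ : ∀ xs : Fin (n + 1) → X,
      ((κ (xs (Fin.last n))).map (fun y => (Fin.snoc xs y : Fin (n + 2) → X))) =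
      ((κ.comap (fun xs : Fin (n + 1) → X => xs (Fin.last n)) (measurable_pi_apply _)) xs).map
        ((fun z : (Fin (n + 1) → X) × X => (Fin.snoc z.1 z.2 : Fin (n + 2) → X)) ∘
          Prod.mk xs) := fun xs => rfl
  have hmeas : Measurable fun xs : Fin (n + 1) → X =>
      (κ (xs (Fin.last n))).map (fun y => (Fin.snoc xs y : Fin (n + 2) → X)) := by
    refine Measure.measurable_of_measurable_coe _ fun t ht => ?_
    simp_rw [Measure.map_apply (hsnoc' _) ht]
    exact Kernel.measurable_kernel_prodMk_left
      (κ := κ.comap (fun xs : Fin (n + 1) → X => xs (Fin.last n)) (measurable_pi_apply _))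
      (hsnoc ht)
  rw [finiteDimLaw, Measure.bind_apply hs hmeas.aemeasurable, Measure.map_apply hsnoc hs,
    Measure.compProd_apply (hsnoc hs)]
  refine lintegral_congr fun xs => ?_
  rw [Measure.map_apply (hsnoc' xs) hs]
  rfl

theorem IsPathMeasure.integral_mul_succ {X : Type*} [MeasurableSpace X] {κ : Kernel X X}
    [IsMarkovKernel κ] {lam : Measure X} {P : Measure (ℕ → X)} [IsProbabilityMeasure P]
    (hP : IsPathMeasure κ lam P) (n : ℕ) {φ : (Fin (n + 1) → X) → ℝ} {g : X → ℝ} {A C : ℝ}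
    (hφ : Measurable φ) (hφA : ∀ a, |φ a| ≤ A) (hg : Measurable g) (hgC : ∀ x, |g x| ≤ C) :
    ∫ ω, φ (fun i => ω i) * g (ω (n + 1)) ∂P =
      ∫ ω, φ (fun i => ω i) * ∫ y, g y ∂κ (ω n) ∂P := by
  have hres : ∀ k : ℕ, Measurable fun (ω : ℕ → X) (i : Fin (k + 1)) => ω (i : ℕ) := fun k =>
    measurable_pi_iff.2 fun i => measurable_pi_apply _
  have hprob : IsProbabilityMeasure (finiteDimLaw κ lam n) := by
    rw [← hP n]; exact Measure.isProbabilityMeasure_map (hres n).aemeasurable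
  have hsnoc := measurable_finSnoc X n
  have hF : Measurable fun ys : Fin (n + 2) → X =>
      φ (fun i => ys i.castSucc) * g (ys (Fin.last (n + 1))) := by fun_prop
  have hG : StronglyMeasurable fun a : Fin (n + 1) → X =>
      φ a * ∫ y, g y ∂κ (a (Fin.last n)) :=
    hφ.stronglyMeasurable.mul
      ((hg.stronglyMeasurable.integral_kernel (κ := κ)).comp_measurable (measurable_pi_apply _))
  calc ∫ ω, φ (fun i => ω i) * g (ω (n + 1)) ∂P
      = ∫ ys, φ (fun i => ys i.castSucc) * g (ys (Fin.last (n + 1)))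
          ∂finiteDimLaw κ lam (n + 1) := by
        rw [← hP (n + 1), integral_map (hres (n + 1)).aemeasurable hF.aestronglyMeasurable]
        simp
    _ = ∫ a, φ a * ∫ y, g y ∂κ (a (Fin.last n)) ∂finiteDimLaw κ lam n := by
        rw [finiteDimLaw_succ_eq_map_compProd,
          integral_map hsnoc.aemeasurable hF.aestronglyMeasurable, Measure.integral_compProd]
        · simp [integral_const_mul]
        · refine Integrable.of_bound (hF.comp hsnoc).aestronglyMeasurable (A * C)
            (ae_of_all _ fun z => ?_)
          simp only [norm_mul]
          exact mul_le_mul (hφA _) (hgC _) (norm_nonneg _) ((abs_nonneg _).trans (hφA z.1))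
    _ = _ := by
        rw [← hP n, integral_map (hres n).aemeasurable hG.aestronglyMeasurable]
        simp

theorem isMarkovKernel_of_eq_sum_dirac {ι X : Type*} [Fintype ι] [MeasurableSpace X]
    {p : ι → X → ℝ} {f : ι → X → X} {κ : Kernel X X} (hp0 : ∀ m x, 0 ≤ p m x)
    (hpsum : ∀ x, ∑ m, p m x = 1)
    (hκ : ∀ x, κ x = ∑ m, ENNReal.ofReal (p m x) • Measure.dirac (f m x)) :
    IsMarkovKernel κ := by
  refine ⟨fun x => ⟨?_⟩⟩
  rw [hκ]
  simp only [Measure.coe_finsetSum, Finset.sum_apply, Measure.smul_apply, measure_univ,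
    smul_eq_mul, mul_one]
  rw [← ENNReal.ofReal_sum_of_nonneg fun m _ => hp0 m x, hpsum, ENNReal.ofReal_one]

theorem integral_eq_ifsOp {ι X : Type*} [Fintype ι] [MeasurableSpace X]
    [MeasurableSingletonClass X]
    {p : ι → X → ℝ} {f : ι → X → X} {κ : Kernel X X} (hp0 : ∀ m x, 0 ≤ p m x)
    (hκ : ∀ x, κ x = ∑ m, ENNReal.ofReal (p m x) • Measure.dirac (f m x))
    (g : X → ℝ) (x : X) : ∫ y, g y ∂κ x = ifsOp p f g x := by
  rw [hκ, integral_finsetSum_measure]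
  · simp [ifsOp, integral_smul_measure, hp0]
  · exact fun m _ => (integrable_dirac (by simp)).smul_measure ENNReal.ofReal_ne_top

theorem IsPathMeasure.ae_mem {X : Type*} [MeasurableSpace X] {κ : Kernel X X}
    [IsMarkovKernel κ] {lam : Measure X} {P : Measure (ℕ → X)} [IsProbabilityMeasure P]
    (hP : IsPathMeasure κ lam P) {B : Set X} (hB : MeasurableSet B) (hlam : ∀ᵐ x ∂lam, x ∈ B)
    (hκB : ∀ x ∈ B, ∀ᵐ y ∂κ x, y ∈ B) : ∀ᵐ ω ∂P, ∀ n, ω n ∈ B := by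
  refine ae_all_iff.2 fun n => ?_
  induction n with
  | zero =>
    have hres : Measurable fun (ω : ℕ → X) (i : Fin (0 + 1)) => ω (i : ℕ) :=
      measurable_pi_iff.2 fun i => measurable_pi_apply _
    have hS : MeasurableSet {a : Fin (0 + 1) → X | a 0 ∈ B} := measurable_pi_apply 0 hB
    have hconst : Measurable fun (x : X) (_ : Fin (0 + 1)) => x :=
      measurable_pi_iff.2 fun _ => measurable_id
    have h0 : ∀ᵐ a ∂finiteDimLaw κ lam 0, a 0 ∈ B :=
      (ae_map_iff hconst.aemeasurable hS).2 hlam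
    rw [← hP 0] at h0
    exact (ae_map_iff hres.aemeasurable hS).1 h0
  | succ n ih =>
    set g : X → ℝ := Bᶜ.indicator 1 with hg
    have hgm : Measurable g := measurable_one.indicator hB.compl
    have hg0 : ∀ x, 0 ≤ g x := fun x => Set.indicator_nonneg (fun _ _ => zero_le_one) x
    have hg1 : ∀ x, |g x| ≤ 1 := fun x => by
      rw [abs_of_nonneg (hg0 x)]
      exact Set.indicator_le_self' (fun _ _ => zero_le_one) x
    have key := hP.integral_mul_succ n (φ := fun _ => 1) (A := 1) measurable_const (by simp)
      hgm hg1
    have hz : ∫ ω, (1 : ℝ) * ∫ y, g y ∂κ (ω n) ∂P = 0 := by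
      refine integral_eq_zero_of_ae ?_
      filter_upwards [ih] with ω hω
      simp only [one_mul, Pi.zero_apply]
      refine integral_eq_zero_of_ae ?_
      filter_upwards [hκB _ hω] with y hy
      simp [hg, hy]
    rw [hz] at key
    simp only [one_mul] at key
    have hcomp : Measurable fun ω : ℕ → X => g (ω (n + 1)) := hgm.comp (measurable_pi_apply _)
    rw [integral_eq_zero_iff_of_nonneg (fun ω => hg0 _)
      (Integrable.of_bound hcomp.aestronglyMeasurable 1 (ae_of_all _ fun ω => hg1 _))] at key
    filter_upwards [key] with ω hω
    by_contra hmem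
    simp [hg, hmem] at hω

/-- Along almost every path, a bounded function and its image under the Markov operator have
asymptotically equal time averages. -/
theorem IsPathMeasure.ae_tendsto_sub_div {X : Type*} [MeasurableSpace X] {κ : Kernel X X}
    [IsMarkovKernel κ] {lam : Measure X} {P : Measure (ℕ → X)} [IsProbabilityMeasure P]
    (hP : IsPathMeasure κ lam P) {g : X → ℝ} {C : ℝ} (hg : Measurable g)
    (hgC : ∀ x, |g x| ≤ C) :
    ∀ᵐ ω ∂P, Tendsto
      (fun n : ℕ => (∑ i ∈ Finset.range n, (g (ω i) - ∫ y, g y ∂κ (ω i))) / (n : ℝ))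
      atTop (𝓝 0) := by
  set T : X → ℝ := fun x => ∫ y, g y ∂κ x with hT
  have hTm : Measurable T := (hg.stronglyMeasurable.integral_kernel (κ := κ)).measurable
  have hTC : ∀ x, |T x| ≤ C := fun x => by
    have := norm_integral_le_of_norm_le_const (μ := κ x) (ae_of_all _ fun y =>
      (Real.norm_eq_abs (g y)).trans_le (hgC y))
    simpa using this
  have hdC : ∀ x y, |g x - T y| ≤ C + C := fun x y =>
    (abs_sub _ _).trans (add_le_add (hgC x) (hTC y))
  have hLLN := ae_tendsto_of_orthogonal (P := P) (ξ := fun i ω => g (ω (i + 1)) - T (ω i))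
    (fun i => (hg.comp (measurable_pi_apply _)).sub (hTm.comp (measurable_pi_apply _)))
    (fun i ω => hdC _ _) (by
      intro i j hij
      set φ : (Fin (j + 1) → X) → ℝ := fun a => g (a ⟨i + 1, by omega⟩) - T (a ⟨i, by omega⟩)
        with hφ
      have hφm : Measurable φ :=
        (hg.comp (measurable_pi_apply _)).sub (hTm.comp (measurable_pi_apply _))
      have key := hP.integral_mul_succ j hφm (fun a => hdC _ _) hg hgC
      have hφm' : Measurable fun ω : ℕ → X => φ fun i => ω i :=
        hφm.comp (g := φ) (f := fun (ω : ℕ → X) (i : Fin (j + 1)) => ω i)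
          (measurable_pi_iff.2 fun i => measurable_pi_apply _)
      have hint : ∀ (k : ℕ) (u : X → ℝ), Measurable u → (∀ x, |u x| ≤ C) →
          Integrable (fun ω : ℕ → X => (φ fun i => ω i) * u (ω k)) P := fun k u hu huC =>
        Integrable.of_bound
          (hφm'.mul (hu.comp (measurable_pi_apply k))).aestronglyMeasurable ((C + C) * C)
          (ae_of_all _ fun ω => by
            rw [norm_mul]
            exact mul_le_mul (hdC _ _) (huC _) (norm_nonneg _)
              ((abs_nonneg _).trans (hdC (ω 0) (ω 0))))
      calc ∫ ω, (g (ω (i + 1)) - T (ω i)) * (g (ω (j + 1)) - T (ω j)) ∂P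
          = ∫ ω, (φ (fun i => ω i) * g (ω (j + 1)) - φ (fun i => ω i) * T (ω j)) ∂P := by
            simp only [hφ, mul_sub]
        _ = 0 := by
            rw [integral_sub (hint _ g hg hgC) (hint _ T hTm hTC), key, sub_self])
  filter_upwards [hLLN] with ω hω
  have hbd : Tendsto (fun n : ℕ => (g (ω 0) - g (ω n)) / (n : ℝ)) atTop (𝓝 0) := by
    refine squeeze_zero_norm (fun n => ?_) (tendsto_const_div_atTop_nhds_zero_nat (C + C))
    rw [norm_div, Real.norm_natCast]
    exact div_le_div_of_nonneg_right ((abs_sub _ _).trans (add_le_add (hgC _) (hgC _)))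
      n.cast_nonneg
  have hadd := hω.add hbd
  rw [add_zero] at hadd
  refine hadd.congr fun n => ?_
  rw [← add_div]
  congr 1
  have h1 := Finset.sum_range_succ (fun i => g (ω i)) n
  have h2 := Finset.sum_range_succ' (fun i => g (ω i)) n
  simp only [Finset.sum_sub_distrib]
  linarith

theorem IsPathMeasure.ae_tendsto_sub_iterate_div {ι X : Type*} [Fintype ι] [TopologicalSpace X]
    [T1Space X] [MeasurableSpace X] [BorelSpace X] {p : ι → X → ℝ} {f : ι → X → X}
    {κ : Kernel X X} [IsMarkovKernel κ] (hp0 : ∀ m x, 0 ≤ p m x) (hpsum : ∀ x, ∑ m, p m x = 1)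
    (hp : ∀ m, Continuous (p m)) (hf : ∀ m, Continuous (f m))
    (hκ : ∀ x, κ x = ∑ m, ENNReal.ofReal (p m x) • Measure.dirac (f m x))
    {lam : Measure X} {P : Measure (ℕ → X)} [IsProbabilityMeasure P]
    (hP : IsPathMeasure κ lam P) {g : X → ℝ} {C : ℝ} (hg : Continuous g)
    (hgC : ∀ x, |g x| ≤ C) :
    ∀ᵐ ω ∂P, ∀ N : ℕ, Tendsto
      (fun n : ℕ => (∑ i ∈ Finset.range n, (g (ω i) - (ifsOp p f)^[N] g (ω i))) / (n : ℝ))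
      atTop (𝓝 0) := by
  have hall : ∀ᵐ ω ∂P, ∀ N : ℕ, Tendsto (fun n : ℕ => (∑ i ∈ Finset.range n,
      ((ifsOp p f)^[N] g (ω i) - (ifsOp p f)^[N + 1] g (ω i))) / (n : ℝ)) atTop (𝓝 0) := by
    refine ae_all_iff.2 fun N => ?_
    have h := hP.ae_tendsto_sub_div (continuous_iterate_ifsOp hp hf hg N).measurable
      (abs_iterate_ifsOp_le hp0 hpsum hgC N)
    simpa only [integral_eq_ifsOp hp0 hκ, ← Function.iterate_succ_apply' (ifsOp p f)] using h
  filter_upwards [hall] with ω hω N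
  induction N with
  | zero => simp
  | succ N ih =>
    have hadd := ih.add (hω N)
    rw [add_zero] at hadd
    refine hadd.congr fun n => ?_
    rw [← add_div, ← Finset.sum_add_distrib]
    congr 1
    exact Finset.sum_congr rfl fun i _ => by ring

theorem integral_iterate_ifsOp {ι X : Type*} [Fintype ι] [TopologicalSpace X]
    [T1Space X] [MeasurableSpace X] [BorelSpace X] {p : ι → X → ℝ} {f : ι → X → X}
    {κ : Kernel X X} [IsMarkovKernel κ] (hp0 : ∀ m x, 0 ≤ p m x) (hpsum : ∀ x, ∑ m, p m x = 1)
    (hp : ∀ m, Continuous (p m)) (hf : ∀ m, Continuous (f m))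
    (hκ : ∀ x, κ x = ∑ m, ENNReal.ofReal (p m x) • Measure.dirac (f m x))
    {μ : Measure X} [IsProbabilityMeasure μ] (hinv : Kernel.Invariant κ μ)
    {g : X → ℝ} {C : ℝ} (hg : Continuous g) (hgC : ∀ x, |g x| ≤ C) (n : ℕ) :
    ∫ x, (ifsOp p f)^[n] g x ∂μ = ∫ x, g x ∂μ := by
  induction n with
  | zero => rfl
  | succ n ih =>
    rw [← ih]
    set h := (ifsOp p f)^[n] g with hh
    have hint : Integrable h (κ ∘ₘ μ) :=
      Integrable.of_bound (continuous_iterate_ifsOp hp hf hg n).measurable.aestronglyMeasurable C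
        (ae_of_all _ (abs_iterate_ifsOp_le hp0 hpsum hgC n))
    rw [Measure.comp_eq_comp_const_apply] at hint
    have hcomp := Kernel.integral_comp hint
    rw [← Measure.comp_eq_comp_const_apply, hinv.def, Kernel.const_apply] at hcomp
    rw [hcomp]
    simp only [integral_eq_ifsOp hp0 hκ, Function.iterate_succ_apply', ← hh]

theorem exists_lipschitz_seq_tendsto_of_bounded {X : Type*} [PseudoMetricSpace X] {g : X → ℝ}
    {C : ℝ} (hg : Continuous g) (hgC : ∀ x, |g x| ≤ C) :
    ∃ G : ℕ → X → ℝ, (∀ k x y, |G k x - G k y| ≤ k * dist x y) ∧ (∀ k x, |G k x| ≤ C) ∧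
      (∀ k x, G k x ≤ g x) ∧ ∀ x, Tendsto (fun k => G k x) atTop (𝓝 (g x)) := by
  have hlow : ∀ (k : ℕ) (x y : X), -C ≤ g y + k * dist x y := fun k x y => by
    have := (abs_le.1 (hgC y)).1
    have : 0 ≤ (k : ℝ) * dist x y := by positivity
    linarith
  have hbdd : ∀ (k : ℕ) (x : X), BddBelow (Set.range fun y => g y + k * dist x y) :=
    fun k x => ⟨-C, by rintro _ ⟨y, rfl⟩; exact hlow k x y⟩
  have hle : ∀ (k : ℕ) (x : X), ⨅ y, (g y + k * dist x y) ≤ g x := fun k x =>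
    (ciInf_le (hbdd k x) x).trans_eq (by simp)
  refine ⟨fun k x => ⨅ y, (g y + k * dist x y), fun k x y => ?_, fun k x => ?_, hle,
    fun x => ?_⟩
  · have hone : ∀ x y : X, (⨅ z, (g z + k * dist x z)) - k * dist x y
        ≤ ⨅ z, (g z + k * dist y z) := by
      intro x y
      have : Nonempty X := ⟨x⟩
      refine le_ciInf fun z => ?_
      have h1 := ciInf_le (hbdd k x) z
      have h2 := mul_le_mul_of_nonneg_left (dist_triangle x y z) (Nat.cast_nonneg (α := ℝ) k)
      linarith
    have h1 := hone x y
    have h2 := hone y x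
    rw [dist_comm y x] at h2
    dsimp only
    exact abs_le.2 ⟨by linarith, by linarith⟩
  · have : Nonempty X := ⟨x⟩
    exact abs_le.2 ⟨le_ciInf fun y => hlow k x y, (hle k x).trans (abs_le.1 (hgC x)).2⟩
  · have : Nonempty X := ⟨x⟩
    refine Metric.tendsto_atTop.2 fun ε hε => ?_
    obtain ⟨η, hη, hcont⟩ := Metric.continuous_iff.1 hg x (ε / 2) (half_pos hε)
    obtain ⟨N, hN⟩ := exists_nat_ge (2 * C / η)
    refine ⟨N, fun k hk => ?_⟩
    have hkη : 2 * C ≤ k * η := by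
      rw [← div_le_iff₀ hη]
      exact hN.trans (by exact_mod_cast hk)
    have hge : g x - ε / 2 ≤ ⨅ y, (g y + k * dist x y) := by
      refine le_ciInf fun y => ?_
      rcases lt_or_ge (dist y x) η with hy | hy
      · have h1 := (abs_lt.1 (hcont y hy)).1
        have : 0 ≤ (k : ℝ) * dist x y := by positivity
        linarith
      · rw [dist_comm] at hy
        have h1 := mul_le_mul_of_nonneg_left hy (Nat.cast_nonneg (α := ℝ) k)
        have h2 := (abs_le.1 (hgC x)).2
        have h3 := (abs_le.1 (hgC y)).1
        linarith
    have := hle k x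
    rw [Real.dist_eq, abs_lt]
    constructor <;> linarith

/-- If the time averages of every bounded Lipschitz function converge almost surely to its
integral, then so do those of every bounded continuous function. -/
theorem ae_tendsto_average_of_lipschitz {X : Type*} [PseudoMetricSpace X] [MeasurableSpace X]
    [BorelSpace X] {μ : Measure X} [IsProbabilityMeasure μ] {P : Measure (ℕ → X)}
    (h : ∀ (g : X → ℝ) (L C : ℝ), 0 ≤ L → (∀ x y, |g x - g y| ≤ L * dist x y) →
      (∀ x, |g x| ≤ C) → ∀ᵐ ω ∂P, Tendsto
        (fun n : ℕ => (∑ i ∈ Finset.range n, g (ω i)) / (n : ℝ)) atTop (𝓝 (∫ x, g x ∂μ)))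
    {g : X → ℝ} {C : ℝ} (hg : Continuous g) (hgC : ∀ x, |g x| ≤ C) :
    ∀ᵐ ω ∂P, Tendsto
      (fun n : ℕ => (∑ i ∈ Finset.range n, g (ω i)) / (n : ℝ)) atTop (𝓝 (∫ x, g x ∂μ)) := by
  have hlower : ∀ g : X → ℝ, Continuous g → (∀ x, |g x| ≤ C) → ∀ᵐ ω ∂P, ∀ c < ∫ x, g x ∂μ,
      ∀ᶠ n : ℕ in atTop, c < (∑ i ∈ Finset.range n, g (ω i)) / (n : ℝ) := by
    intro g hg hgC
    obtain ⟨G, hGlip, hGC, hGle, hGlim⟩ := exists_lipschitz_seq_tendsto_of_bounded hg hgC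
    have hGcont : ∀ k, Continuous (G k) := fun k =>
      (LipschitzWith.of_dist_le_mul (K := k) fun x y => by
        simpa [Real.dist_eq] using hGlip k x y).continuous
    have hint : Tendsto (fun k => ∫ x, G k x ∂μ) atTop (𝓝 (∫ x, g x ∂μ)) :=
      tendsto_integral_of_dominated_convergence (fun _ => C)
        (fun k => (hGcont k).measurable.aestronglyMeasurable) (integrable_const _)
        (fun k => ae_of_all _ (hGC k)) (ae_of_all _ hGlim)
    filter_upwards [ae_all_iff.2 fun k : ℕ => h (G k) k C k.cast_nonneg (hGlip k) (hGC k)]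
      with ω hω c hc
    obtain ⟨k, hk⟩ := (hint.eventually_const_lt hc).exists
    filter_upwards [(hω k).eventually_const_lt hk] with n hn
    exact hn.trans_le (div_le_div_of_nonneg_right
      (Finset.sum_le_sum fun i _ => hGle k (ω i)) n.cast_nonneg)
  filter_upwards [hlower g hg hgC, hlower (fun x => -g x) hg.neg (by simpa using hgC)]
    with ω h1 h2
  refine tendsto_order.2 ⟨h1, fun c hc => ?_⟩
  rw [integral_neg] at h2
  filter_upwards [h2 (-c) (neg_lt_neg hc)] with n hn
  rw [Finset.sum_neg_distrib, neg_div] at hn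
  exact neg_lt_neg_iff.1 hn

theorem exists_mapsTo_closedBall {ι X : Type*} [Fintype ι] [PseudoMetricSpace X]
    {f : ι → X → X} {r : ℝ} (hr : 0 ≤ r) (hr1 : r < 1)
    (hf : ∀ m x y, dist (f m x) (f m y) ≤ r * dist x y) (x₀ : X) :
    ∃ R₀, 0 ≤ R₀ ∧ ∀ R, R₀ ≤ R → ∀ m,
      Set.MapsTo (f m) (Metric.closedBall x₀ R) (Metric.closedBall x₀ R) := by
  have hr1' : 0 < 1 - r := sub_pos.2 hr1
  refine ⟨(∑ m, dist (f m x₀) x₀) / (1 - r),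
    div_nonneg (Finset.sum_nonneg fun _ _ => dist_nonneg) hr1'.le, fun R hR m x hx => ?_⟩
  rw [div_le_iff₀ hr1'] at hR
  rw [Metric.mem_closedBall] at hx ⊢
  have h1 := Finset.single_le_sum (f := fun m => dist (f m x₀) x₀)
    (fun _ _ => dist_nonneg) (Finset.mem_univ m)
  have h2 := hf m x x₀
  have h3 := mul_le_mul_of_nonneg_left hx hr
  have h4 := dist_triangle (f m x) (f m x₀) x₀
  linarith

section Contractive

variable {ι X : Type*} [Fintype ι] [Nonempty ι] [MetricSpace X] [MeasurableSpace X]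
  [BorelSpace X] {p : ι → X → ℝ} {f : ι → X → X} {δ r K : ℝ}

/-- For a contractive iterated function system, the iterates of the transfer operator applied to
a bounded Lipschitz function converge to its integral against an invariant probability measure,
uniformly on bounded forward-invariant balls. -/
theorem eventually_abs_iterate_ifsOp_sub_integral_le (hpδ : ∀ m x, δ ≤ p m x)
    (hpsum : ∀ x, ∑ m, p m x = 1)
    (hδ : 0 < δ) (hr : 0 ≤ r) (hr1 : r < 1) (hK : 0 ≤ K)
    (hpK : ∀ m x y, |p m x - p m y| ≤ K * dist x y)
    (hf : ∀ m x y, dist (f m x) (f m y) ≤ r * dist x y)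
    (hpc : ∀ m, Continuous (p m)) (hfc : ∀ m, Continuous (f m))
    {κ : Kernel X X} [IsMarkovKernel κ]
    (hκ : ∀ x, κ x = ∑ m, ENNReal.ofReal (p m x) • Measure.dirac (f m x))
    {μ : Measure X} [IsProbabilityMeasure μ] (hinv : Kernel.Invariant κ μ) {x₀ : X} {R₀ : ℝ}
    (hR₀ : 0 ≤ R₀) (hball : ∀ R, R₀ ≤ R → ∀ m,
      Set.MapsTo (f m) (Metric.closedBall x₀ R) (Metric.closedBall x₀ R))
    {g : X → ℝ} {L C : ℝ} (hL : 0 ≤ L) (hg : ∀ x y, |g x - g y| ≤ L * dist x y)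
    (hgc : Continuous g) (hgC : ∀ x, |g x| ≤ C) {ε : ℝ} (hε : 0 < ε) :
    ∀ᶠ n in atTop, ∀ x ∈ Metric.closedBall x₀ R₀,
      |(ifsOp p f)^[n] g x - ∫ y, g y ∂μ| ≤ ε := by
  have hp0 : ∀ m x, 0 ≤ p m x := fun m x => hδ.le.trans (hpδ m x)
  have hosc : ∀ R, R₀ ≤ R → ∀ ε > 0, ∀ᶠ n in atTop,
      ∀ x ∈ Metric.closedBall x₀ R, ∀ y ∈ Metric.closedBall x₀ R,
        |(ifsOp p f)^[n] g x - (ifsOp p f)^[n] g y| ≤ ε := fun R hR ε hε =>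
    eventually_abs_iterate_ifsOp_sub_le (D := R + R) hpδ hpsum hδ hr hr1 hK hpK hf (hball R hR)
      (fun x hx y hy => (dist_triangle_right x y x₀).trans (add_le_add hx hy)) hL hg hε
  have hpt : ∀ y, Tendsto (fun n => (ifsOp p f)^[n] g y - (ifsOp p f)^[n] g x₀) atTop (𝓝 0) := by
    intro y
    refine Metric.tendsto_nhds.2 fun η hη => ?_
    filter_upwards [hosc (max R₀ (dist y x₀)) (le_max_left _ _) (η / 2) (half_pos hη)] with n hn
    rw [Real.dist_eq, sub_zero]
    exact (hn y (Metric.mem_closedBall.2 (le_max_right _ _)) x₀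
      (Metric.mem_closedBall_self (hR₀.trans (le_max_left _ _)))).trans_lt (half_lt_self hη)
  have hcont := continuous_iterate_ifsOp hpc hfc hgc
  have hbd := abs_iterate_ifsOp_le (f := f) hp0 hpsum hgC
  have hlim : Tendsto (fun n => ∫ y, ((ifsOp p f)^[n] g y - (ifsOp p f)^[n] g x₀) ∂μ) atTop
      (𝓝 (∫ _, (0 : ℝ) ∂μ)) :=
    tendsto_integral_of_dominated_convergence (fun _ => C + C)
      (fun n => ((hcont n).sub continuous_const).measurable.aestronglyMeasurable)
      (integrable_const _)
      (fun n => ae_of_all _ fun y => (abs_sub _ _).trans (add_le_add (hbd n y) (hbd n x₀)))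
      (ae_of_all _ hpt)
  have heq : ∀ n, ∫ y, ((ifsOp p f)^[n] g y - (ifsOp p f)^[n] g x₀) ∂μ
      = ∫ y, g y ∂μ - (ifsOp p f)^[n] g x₀ := fun n => by
    rw [integral_sub (Integrable.of_bound (hcont n).measurable.aestronglyMeasurable C
      (ae_of_all _ (hbd n))) (integrable_const _),
      integral_iterate_ifsOp hp0 hpsum hpc hfc hκ hinv hgc hgC]
    simp
  simp only [heq, integral_zero] at hlim
  filter_upwards [hosc R₀ le_rfl (ε / 2) (half_pos hε),
    Metric.tendsto_nhds.1 hlim (ε / 2) (half_pos hε)] with n h1 h2 x hx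
  have h3 := h1 x hx x₀ (Metric.mem_closedBall_self hR₀)
  rw [Real.dist_eq, sub_zero, abs_sub_comm] at h2
  have := abs_sub_le ((ifsOp p f)^[n] g x) ((ifsOp p f)^[n] g x₀) (∫ y, g y ∂μ)
  linarith

theorem IsPathMeasure.ae_tendsto_average_of_lipschitz (hpδ : ∀ m x, δ ≤ p m x)
    (hpsum : ∀ x, ∑ m, p m x = 1)
    (hδ : 0 < δ) (hr : 0 ≤ r) (hr1 : r < 1) (hK : 0 ≤ K)
    (hpK : ∀ m x y, |p m x - p m y| ≤ K * dist x y)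
    (hf : ∀ m x y, dist (f m x) (f m y) ≤ r * dist x y)
    (hpc : ∀ m, Continuous (p m)) (hfc : ∀ m, Continuous (f m))
    {κ : Kernel X X} [IsMarkovKernel κ]
    (hκ : ∀ x, κ x = ∑ m, ENNReal.ofReal (p m x) • Measure.dirac (f m x))
    {μ : Measure X} [IsProbabilityMeasure μ] (hinv : Kernel.Invariant κ μ) {x₀ : X}
    {P : Measure (ℕ → X)} [IsProbabilityMeasure P]
    (hP : IsPathMeasure κ (Measure.dirac x₀) P)
    {g : X → ℝ} {L C : ℝ} (hL : 0 ≤ L) (hg : ∀ x y, |g x - g y| ≤ L * dist x y)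
    (hgC : ∀ x, |g x| ≤ C) :
    ∀ᵐ ω ∂P, Tendsto
      (fun n : ℕ => (∑ i ∈ Finset.range n, g (ω i)) / (n : ℝ)) atTop (𝓝 (∫ x, g x ∂μ)) := by
  have hp0 : ∀ m x, 0 ≤ p m x := fun m x => hδ.le.trans (hpδ m x)
  have hgc : Continuous g := (LipschitzWith.of_dist_le_mul (K := ⟨L, hL⟩) hg).continuous
  obtain ⟨R₀, hR₀, hball⟩ := exists_mapsTo_closedBall hr hr1 hf x₀
  have hmem : ∀ᵐ ω ∂P, ∀ n, ω n ∈ Metric.closedBall x₀ R₀ := by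
    refine hP.ae_mem Metric.isClosed_closedBall.measurableSet ?_ fun x hx => ?_
    · rw [ae_dirac_eq]
      exact Metric.mem_closedBall_self hR₀
    · rw [hκ, ae_iff]
      simp only [Measure.coe_finsetSum, Finset.sum_apply, Measure.smul_apply, smul_eq_mul]
      refine Finset.sum_eq_zero fun m _ => ?_
      rw [Measure.dirac_apply, Set.indicator_of_notMem, mul_zero]
      exact fun hnot => hnot (hball R₀ le_rfl m hx)
  filter_upwards [hmem, hP.ae_tendsto_sub_iterate_div hp0 hpsum hpc hfc hκ hgc hgC]
    with ω hω hdiff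
  refine Metric.tendsto_nhds.2 fun ε hε => ?_
  obtain ⟨N, hN⟩ := (eventually_abs_iterate_ifsOp_sub_integral_le hpδ hpsum hδ hr hr1 hK hpK hf
    hpc hfc hκ hinv hR₀ hball hL hg hgc hgC (half_pos hε)).exists
  filter_upwards [Metric.tendsto_nhds.1 (hdiff N) (ε / 2) (half_pos hε), eventually_gt_atTop 0]
    with n hn hn0
  have hn0' : (0 : ℝ) < n := by exact_mod_cast hn0
  rw [Real.dist_eq, sub_zero] at hn
  rw [Real.dist_eq]
  have hsplit : (∑ i ∈ Finset.range n, g (ω i)) / (n : ℝ) - ∫ x, g x ∂μ =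
      (∑ i ∈ Finset.range n, (g (ω i) - (ifsOp p f)^[N] g (ω i))) / (n : ℝ) +
      (∑ i ∈ Finset.range n, ((ifsOp p f)^[N] g (ω i) - ∫ x, g x ∂μ)) / (n : ℝ) := by
    simp only [Finset.sum_sub_distrib, Finset.sum_const, Finset.card_range, nsmul_eq_mul]
    field_simp
    ring
  have hsecond : |(∑ i ∈ Finset.range n, ((ifsOp p f)^[N] g (ω i) - ∫ x, g x ∂μ)) / (n : ℝ)|
      ≤ ε / 2 := by
    rw [abs_div, abs_of_pos hn0', div_le_iff₀ hn0']
    calc |∑ i ∈ Finset.range n, ((ifsOp p f)^[N] g (ω i) - ∫ x, g x ∂μ)|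
        ≤ ∑ i ∈ Finset.range n, ε / 2 :=
          (Finset.abs_sum_le_sum_abs _ _).trans (Finset.sum_le_sum fun i _ => hN _ (hω i))
      _ = ε / 2 * n := by simp; ring
  rw [hsplit]
  have := abs_add_le ((∑ i ∈ Finset.range n, (g (ω i) - (ifsOp p f)^[N] g (ω i))) / (n : ℝ))
    ((∑ i ∈ Finset.range n, ((ifsOp p f)^[N] g (ω i) - ∫ x, g x ∂μ)) / (n : ℝ))
  linarith

end Contractive

/-- **Elton's ergodic theorem for contractive IFS (predictability; paper's Theorem 5).**
For a contractive IFS with Lipschitz place-dependent probabilities bounded below, with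
unique invariant probability measure `μ`: for every deterministic initial condition `x₀`
and every bounded continuous `g`, the time averages `(1/(k+1)) Σ_{ν≤k} g(X(ν))` converge,
almost surely w.r.t. the path measure of the chain started at `x₀`, to `∫ g dμ`; in
particular the limit is independent of `x₀`. -/
theorem contractive_IFS_time_averages_converge
    {X : Type*} [MetricSpace X] [CompleteSpace X] [TopologicalSpace.SeparableSpace X]
    [MeasurableSpace X] [BorelSpace X]
    (M : ℕ) (hM : 1 ≤ M)
    (f : Fin M → X → X) (l : Fin M → NNReal)
    (hl : ∀ m, l m < 1) (hf : ∀ m, LipschitzWith (l m) (f m))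
    (p : Fin M → X → ℝ) (δ : ℝ) (hδ : 0 < δ)
    (hplip : ∀ m, ∃ K : NNReal, LipschitzWith K (p m))
    (hp01 : ∀ m x, p m x ∈ Set.Icc (0 : ℝ) 1)
    (hpsum : ∀ x, ∑ m, p m x = 1)
    (hpδ : ∀ m x, δ ≤ p m x)
    (κ : Kernel X X)
    (hκ : ∀ x, κ x = ∑ m, ENNReal.ofReal (p m x) • Measure.dirac (f m x))
    (μ : Measure X) [IsProbabilityMeasure μ] (hinv : Kernel.Invariant κ μ)
    (huniq : ∀ ν : Measure X, IsProbabilityMeasure ν → Kernel.Invariant κ ν → ν = μ) :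
    ∀ x₀ : X, ∀ P : Measure (ℕ → X), IsProbabilityMeasure P →
      IsPathMeasure κ (Measure.dirac x₀) P →
      ∀ g : BoundedContinuousFunction X ℝ,
        ∀ᵐ ω ∂P, Tendsto
          (fun k : ℕ => (1 / (k + 1 : ℝ)) * ∑ ν ∈ Finset.range (k + 1), g (ω ν))
          atTop (𝓝 (∫ x, g x ∂μ)) := by
  intro x₀ P hPprob hP g
  have : Nonempty (Fin M) := ⟨⟨0, hM⟩⟩
  choose K hK using hplip
  have hp0 : ∀ m x, 0 ≤ p m x := fun m x => (hp01 m x).1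
  have hκM : IsMarkovKernel κ := isMarkovKernel_of_eq_sum_dirac hp0 hpsum hκ
  have hr1 : Finset.univ.sup l < 1 := (Finset.sup_lt_iff zero_lt_one).2 fun m _ => hl m
  have hfr : ∀ m x y, dist (f m x) (f m y) ≤ (Finset.univ.sup l : NNReal) * dist x y :=
    fun m => ((hf m).weaken (Finset.le_sup (Finset.mem_univ m))).dist_le_mul
  have hpK : ∀ m x y, |p m x - p m y| ≤ (Finset.univ.sup K : NNReal) * dist x y :=
    fun m => ((hK m).weaken (Finset.le_sup (Finset.mem_univ m))).dist_le_mul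
  have havg := ae_tendsto_average_of_lipschitz (P := P) (μ := μ) (fun u L C hL hu huC =>
    hP.ae_tendsto_average_of_lipschitz hpδ hpsum hδ (NNReal.coe_nonneg _) (by exact_mod_cast hr1)
      (NNReal.coe_nonneg _) hpK hfr (fun m => (hK m).continuous) (fun m => (hf m).continuous)
      hκ hinv hL hu huC) g.continuous fun x => g.norm_coe_le_norm x
  filter_upwards [havg] with ω hω
  refine (hω.comp (tendsto_add_atTop_nat 1)).congr fun k => ?_
  simp only [Function.comp_apply, Nat.cast_add, Nat.cast_one]
  rw [div_eq_inv_mul, one_div]
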